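/- Let i ≥ 1 and let G_i be the acyclic digraph with source s, sink t, and i internally-disjoint directed s–t paths each with two internal vertices a_j, b_j. Then G_i has exactly 3i connected convex sets contained in V(G_i) \ {s, t}, namely the sets {a_j}, {b_j}, and {a_j, b_j} for j ∈ {1,…,i}. -/

import Mathlib

/-!
Digraphs are given by an arc relation `A : V → V → Prop` on a vertex type `V`.
A directed path from `a` to `b` is encoded as `a :: (l ++ [b])` where the list
satisfies `List.Chain A` (consecutive arcs) and `List.Nodup` (distinct vertices);
`l` is the list of internal vertices.
-/

variable {V : Type*}

/-- A non-empty vertex set `X` is convex if no directed path between two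
vertices of `X` contains a vertex not in `X`. -/
def ConvexIn (A : V → V → Prop) (X : Set V) : Prop :=
  X.Nonempty ∧ ∀ a b : V, ∀ l : List V, a ∈ X → b ∈ X →
    List.Chain A a (l ++ [b]) → (a :: (l ++ [b])).Nodup → ∀ w ∈ l, w ∈ X

/-- A vertex set is connected if the underlying undirected graph induced on it
is connected. -/
def ConnectedIn (A : V → V → Prop) (X : Set V) : Prop :=
  ((SimpleGraph.fromRel A).induce X).Connected

/-- A digraph is acyclic if it has no directed cycle, equivalently no
nontrivial directed closed walk. -/
def AcyclicDigraph (A : V → V → Prop) : Prop :=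
  ∀ v, ¬ Relation.TransGen A v v

/-- A digraph is connected if its underlying undirected graph is connected. -/
def DigraphConnected (A : V → V → Prop) : Prop :=
  (SimpleGraph.fromRel A).Connected

/-- A source is a vertex with in-degree zero. -/
def IsSourceIn (A : V → V → Prop) (v : V) : Prop := ∀ u, ¬ A u v

/-- A sink is a vertex with out-degree zero. -/
def IsSinkIn (A : V → V → Prop) (v : V) : Prop := ∀ u, ¬ A v u

/-- A cut-vertex of a connected digraph: deleting it disconnects the
underlying undirected graph. -/
def IsCutVertexIn (A : V → V → Prop) (v : V) : Prop :=
  ¬ ((SimpleGraph.fromRel A).induce {u | u ≠ v}).Connected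

/-- Vertices of the digraph `G_i`: a source `s`, a sink `t`, and internal
vertices `a j`, `b j` on the `j`-th path, for `j : Fin i`. -/
inductive GV (i : ℕ) : Type
  | s : GV i
  | t : GV i
  | a : Fin i → GV i
  | b : Fin i → GV i
deriving DecidableEq

/-- Arcs of `G_i`: `s → a j`, `a j → b j`, `b j → t` for each `j`. -/
def GAdj {i : ℕ} : GV i → GV i → Prop
  | GV.s, GV.a _ => True
  | GV.a j, GV.b k => j = k
  | GV.b _, GV.t => True
  | _, _ => False

/-- The internal vertices `a j` and `b j` of the `j`-th path. -/
def internalPair {i : ℕ} (j : Fin i) : Set (GV i) := {GV.a j, GV.b j}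

theorem exists_mem_internalPair {i : ℕ} {v : GV i} (hs : v ≠ GV.s) (ht : v ≠ GV.t) :
    ∃ j, v ∈ internalPair j := by
  cases v <;> simp_all [internalPair]

/-- An edge leaving `{a j, b j}` ends in `s` or `t`. -/
theorem mem_internalPair_of_adj {i : ℕ} {j : Fin i} {u v : GV i} (hu : u ∈ internalPair j)
    (huv : (SimpleGraph.fromRel GAdj).Adj u v) (hs : v ≠ GV.s) (ht : v ≠ GV.t) :
    v ∈ internalPair j := by
  cases u <;> cases v <;> simp_all [internalPair, GAdj]

theorem ConnectedIn.exists_subset_internalPair {i : ℕ} {X : Set (GV i)}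
    (hX : ConnectedIn GAdj X) (hst : X ⊆ {v : GV i | v ≠ GV.s ∧ v ≠ GV.t}) :
    ∃ j, X ⊆ internalPair j := by
  obtain ⟨x⟩ := hX.nonempty
  obtain ⟨j, hj⟩ := exists_mem_internalPair (hst x.2).1 (hst x.2).2
  refine ⟨j, fun y hy => ?_⟩
  obtain ⟨w⟩ := hX.preconnected x ⟨y, hy⟩
  have key : ∀ {u v : X}, ((SimpleGraph.fromRel GAdj).induce X).Walk u v →
      (u : GV i) ∈ internalPair j → (v : GV i) ∈ internalPair j := by
    intro u v w
    induction w with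
    | nil => exact id
    | @cons u v _ h _ ih =>
      exact fun hu => ih (mem_internalPair_of_adj hu h (hst v.2).1 (hst v.2).2)
  exact key w hj

/-- No directed path between vertices of `{a j, b j}` has an internal vertex. -/
theorem convexIn_of_subset_internalPair {i : ℕ} {j : Fin i} {X : Set (GV i)}
    (hne : X.Nonempty) (hX : X ⊆ internalPair j) : ConvexIn GAdj X := by
  refine ⟨hne, fun x y l hx hy hl _ w hw => ?_⟩
  have hy' := hX hy
  change List.IsChain GAdj (x :: (l ++ [y])) at hl
  rcases hX hx with rfl | rfl
  · match l with
    | [] => simp at hw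
    | [c] => cases c <;> cases y <;> simp_all [internalPair, GAdj]
    | c :: d :: l =>
      obtain ⟨e, m, he⟩ : ∃ e m, l ++ [y] = e :: m := List.exists_cons_of_ne_nil (by simp)
      cases c <;> cases d <;> simp_all [GAdj]
  · match l with
    | [] => simp at hw
    | c :: l =>
      obtain ⟨e, m, he⟩ : ∃ e m, l ++ [y] = e :: m := List.exists_cons_of_ne_nil (by simp)
      cases c <;> simp_all [GAdj]

theorem connectedIn_singleton {V : Type*} (A : V → V → Prop) (v : V) : ConnectedIn A {v} :=
  SimpleGraph.Connected.of_subsingleton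

theorem connectedIn_internalPair {i : ℕ} (j : Fin i) : ConnectedIn GAdj (internalPair j) :=
  SimpleGraph.induce_pair_connected_of_adj (by simp [GAdj])

theorem internalPair_subset {i : ℕ} (j : Fin i) :
    internalPair j ⊆ {v : GV i | v ≠ GV.s ∧ v ≠ GV.t} := by
  rintro v (rfl | rfl) <;> simp

theorem connected_convex_iff {i : ℕ} (X : Set (GV i)) :
    (ConnectedIn GAdj X ∧ ConvexIn GAdj X ∧ X ⊆ {v : GV i | v ≠ GV.s ∧ v ≠ GV.t}) ↔
      ∃ j : Fin i, X = {GV.a j} ∨ X = {GV.b j} ∨ X = {GV.a j, GV.b j} := by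
  constructor
  · rintro ⟨hconn, hconv, hst⟩
    obtain ⟨j, hj⟩ := hconn.exists_subset_internalPair hst
    exact ⟨j, (Set.subset_pair_iff_eq.mp hj).resolve_left hconv.1.ne_empty⟩
  · rintro ⟨j, hX⟩
    have hsub : X ⊆ internalPair j := Set.subset_pair_iff_eq.mpr (Or.inr hX)
    have hne : X.Nonempty := by rcases hX with rfl | rfl | rfl <;> simp
    refine ⟨?_, convexIn_of_subset_internalPair hne hsub, hsub.trans (internalPair_subset j)⟩
    rcases hX with rfl | rfl | rfl
    · exact connectedIn_singleton _ _
    · exact connectedIn_singleton _ _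
    · exact connectedIn_internalPair j

/-- The sets `{a j}`, `{b j}` and `{a j, b j}` as an indexed family. -/
def internalFamily (i : ℕ) : Fin i ⊕ Fin i ⊕ Fin i → Set (GV i) :=
  Sum.elim (fun j => {GV.a j}) (Sum.elim (fun j => {GV.b j}) internalPair)

theorem internalFamily_injective (i : ℕ) : Function.Injective (internalFamily i) := by
  rintro (j | j | j) (k | k | k) h
  all_goals
    have haj := Set.ext_iff.mp h (GV.a j)
    have hbj := Set.ext_iff.mp h (GV.b j)
    have hak := Set.ext_iff.mp h (GV.a k)
    have hbk := Set.ext_iff.mp h (GV.b k)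
    clear h
    simp_all [internalFamily, internalPair]

theorem range_internalFamily (i : ℕ) :
    Set.range (internalFamily i) = {X : Set (GV i) | ∃ j : Fin i,
      X = {GV.a j} ∨ X = {GV.b j} ∨ X = {GV.a j, GV.b j}} := by
  ext X
  simp [internalFamily, internalPair, exists_or, eq_comm]

/-- The connected convex sets of `G_i` avoiding `s` and `t` are exactly the
`3i` sets `{a j}`, `{b j}` and `{a j, b j}`. -/
theorem stmt_12 (i : ℕ) (hi : 1 ≤ i) :
    {X : Set (GV i) | ConnectedIn GAdj X ∧ ConvexIn GAdj X ∧
        X ⊆ {v : GV i | v ≠ GV.s ∧ v ≠ GV.t}} =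
      {X : Set (GV i) | ∃ j : Fin i,
        X = {GV.a j} ∨ X = {GV.b j} ∨ X = {GV.a j, GV.b j}} ∧
    {X : Set (GV i) | ConnectedIn GAdj X ∧ ConvexIn GAdj X ∧
        X ⊆ {v : GV i | v ≠ GV.s ∧ v ≠ GV.t}}.ncard = 3 * i := by
  have hset := Set.ext (connected_convex_iff (i := i))
  refine ⟨hset, (congrArg Set.ncard hset).trans ?_⟩
  change Set.ncard {X : Set (GV i) | _} = _
  rw [← range_internalFamily, ← Set.image_univ,
    Set.ncard_image_of_injective _ (internalFamily_injective i), Set.ncard_univ]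
  simp
  ring
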